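/- Let k be a field and (A, d, h) a cdga over k. Then on Hom_k(T, A) with the convolution product ⋆ and differential d_Hom(f) = d∘f − (−1)^{|f|}f∘δ_T, one has d_Hom ∘ d_Hom = [h∘ε, −]⋆ (the convolution commutator with the degree-2 element h∘ε) and d_Hom(h∘ε) = 0; consequently (Hom_k(T,A), ⋆, d_Hom, h∘ε) is a curved differential Γ-graded algebra over k. -/

import Mathlib

noncomputable section

open Finset

/-- The grading group `Γ` (to be thought of as `ℤ` or `ℤ/2ℤ`): an additive
commutative group with one, together with its parity homomorphism to `ℤ/2ℤ`
(through which all Koszul signs are computed). -/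
class GradingGroup (Γ : Type) extends AddCommGroupWithOne Γ where
  parity : Γ →+ ZMod 2
  parity_one : parity 1 = 1

/-- The Koszul sign `(−1)^{|γ|}` in `k`. -/
def gsign (k : Type) [Field k] {Γ : Type} [GradingGroup Γ] (γ : Γ) : k :=
  (-1 : k) ^ (GradingGroup.parity γ).val

/-- The Koszul sign `(−1)^{|γ|·|γ'|}` in `k`. -/
def gsign2 (k : Type) [Field k] {Γ : Type} [GradingGroup Γ] (γ γ' : Γ) : k :=
  (-1 : k) ^ (GradingGroup.parity γ * GradingGroup.parity γ').val

/-- `degSum g j = g 0 + ⋯ + g (j-1)` : the sum of the first `j` degrees. -/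
def degSum {Γ : Type} [GradingGroup Γ] (g : ℕ → Γ) (j : ℕ) : Γ :=
  ∑ t ∈ Finset.range j, g t

/-- Read a sequence cyclically with period `m + 1`. -/
def cyc {α : Type} (m : ℕ) (X : ℕ → α) : ℕ → α := fun i => X (i % (m + 1))

/-- Contract a chain at position `j`, multiplying the `j`-th and `(j+1)`-st entries. -/
def contractChain {E : Type} [Mul E] (a : ℕ → E) (j : ℕ) : ℕ → E :=
  fun i => if i < j then a i else if i = j then a j * a (j + 1) else a (i + 1)

/-- Omit the `(j+1)`-st term of a sequence of objects. -/
def dropIdx {α : Type} (X : ℕ → α) (j : ℕ) : ℕ → α :=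
  fun i => if i ≤ j then X i else X (i + 1)

/-- Insert `x` into a chain after position `j`. -/
def insertChain {E : Type} (a : ℕ → E) (j : ℕ) (x : E) : ℕ → E :=
  fun i => if i ≤ j then a i else if i = j + 1 then x else a (i - 1)

/-- Insert `x` into a chain so that it occupies position `j`. -/
def insertAt {E : Type} (a : ℕ → E) (j : ℕ) (x : E) : ℕ → E :=
  fun i => if i < j then a i else if i = j then x else a (i - 1)

/-- Duplicate the `(j+1)`-st term of a sequence of objects. -/
def dupIdx {α : Type} (X : ℕ → α) (j : ℕ) : ℕ → α :=
  fun i => if i ≤ j + 1 then X i else X (i - 1)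

/-- The ordered product `f 0 * f 1 * ⋯ * f m`. -/
def chainProd {E : Type} [Mul E] (f : ℕ → E) : ℕ → E
  | 0 => f 0
  | m + 1 => chainProd f m * f (m + 1)

/-- Extend a `Fin (n+1)`-tuple of naturals by zero. -/
def extTuple {n : ℕ} (v : Fin (n + 1) → ℕ) : ℕ → ℕ :=
  fun t => if h : t < n + 1 then v ⟨t, h⟩ else 0


/-- A curved differential `Γ`-graded algebra `(A, d, h)` over `k`: a unital `Γ`-graded
`k`-algebra `A` with a degree-one `k`-linear derivation `d` and a degree-two curvature
element `h` satisfying `d² = [h,−]` and `d(h) = 0`. -/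
structure CurvedDGA (k Γ : Type) [Field k] [GradingGroup Γ] where
  A : Type
  [ringA : Ring A]
  [algA : Algebra k A]
  deg : Γ → Submodule k A
  one_mem : (1 : A) ∈ deg 0
  mul_mem : ∀ {γ γ' : Γ} {a b : A}, a ∈ deg γ → b ∈ deg γ' → a * b ∈ deg (γ + γ')
  d : A →ₗ[k] A
  hEl : A
  d_deg : ∀ {γ : Γ} {a : A}, a ∈ deg γ → d a ∈ deg (γ + 1)
  d_leibniz : ∀ {γ : Γ} {a : A}, a ∈ deg γ → ∀ b : A,
      d (a * b) = d a * b + gsign k γ • (a * d b)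
  h_deg : hEl ∈ deg 2
  d_sq : ∀ a : A, d (d a) = hEl * a - a * hEl
  d_h : d hEl = 0

attribute [instance] CurvedDGA.ringA CurvedDGA.algA

variable {k Γ : Type} [Field k] [GradingGroup Γ]

/-- Each `a i` (for `i ≤ n`) is homogeneous of degree `g i`. -/
def CurvedDGA.Homog (R : CurvedDGA k Γ) (n : ℕ) (g : ℕ → Γ) (a : ℕ → R.A) : Prop :=
  ∀ i ≤ n, a i ∈ R.deg (g i)


open TensorProduct

/-- The sign `(−1)^{p·q}` for parities `p, q : ℤ/2`. -/
def psign (k : Type) [Field k] (p q : ZMod 2) : k := (-1 : k) ^ (p * q).val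

variable {k Γ : Type} [Field k] [GradingGroup Γ]

/-- Each `a i` (for `i < n`) is homogeneous of degree `g i` (bar-chain version:
`tgen n a` models `[a₀|⋯|a_{n−1}]`, of degree `∑|aᵢ| − n`). -/
def CurvedDGA.HomogBar (R : CurvedDGA k Γ) (n : ℕ) (g : ℕ → Γ) (a : ℕ → R.A) : Prop :=
  ∀ i < n, a i ∈ R.deg (g i)

/-- A model of the components `T n = (ΣA)^{⊗n}` of the tensor (bar) coalgebra
`T = T(A) = ⊕ₙ (ΣA)^{⊗n}` of a cdga `(A, d, h)`, together with:
the deconcatenation coproduct `Δ`, recorded through its components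
`cop n i : T n → T i ⊗ T (n−i)`; the `Γ`-grading `tdeg`; the parity sign operators
`sgnOp n p` (multiplying the degree-`γ` part by `(−1)^{p·|γ|}`, which encode the
Koszul signs of `f ⊗ g`); and the three coderivations `δ⁽²⁾, δ⁽¹⁾, δ⁽⁰⁾` determined
by `[a|b] ↦ (−1)^{|a|−1}[ab]`, `[a] ↦ −[da]`, `[] ↦ [h]`, with their explicit
formulas on homogeneous generators. -/
structure BarParts (k Γ : Type) [Field k] [GradingGroup Γ] (R : CurvedDGA k Γ) where
  T : ℕ → Type
  [addT : ∀ n, AddCommGroup (T n)]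
  [modT : ∀ n, Module k (T n)]
  tgen : (n : ℕ) → (ℕ → R.A) → T n
  tgen_ext : ∀ {n : ℕ} {a a' : ℕ → R.A}, (∀ i < n, a i = a' i) → tgen n a = tgen n a'
  tgen_add : ∀ (n : ℕ) (a : ℕ → R.A) (i : ℕ), i < n → ∀ x y : R.A,
      tgen n (Function.update a i (x + y)) =
        tgen n (Function.update a i x) + tgen n (Function.update a i y)
  tgen_smul : ∀ (n : ℕ) (a : ℕ → R.A) (i : ℕ), i < n → ∀ (c : k) (x : R.A),
      tgen n (Function.update a i (c • x)) = c • tgen n (Function.update a i x)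
  span_tgen : ∀ n : ℕ, Submodule.span k
      {w : T n | ∃ a g, R.HomogBar n g a ∧ w = tgen n a} = ⊤
  tdeg : (n : ℕ) → Γ → Submodule k (T n)
  tgen_deg : ∀ {n : ℕ} {a : ℕ → R.A} {g : ℕ → Γ}, R.HomogBar n g a →
      tgen n a ∈ tdeg n (degSum g n - (n : Γ))
  cop : (n i j : ℕ) → T n →ₗ[k] (T i ⊗[k] T j)
  cop_gen : ∀ (i j : ℕ) (a : ℕ → R.A),
      cop (i + j) i j (tgen (i + j) a) = tgen i a ⊗ₜ[k] tgen j (fun t => a (t + i))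
  cop_zero : ∀ {n i j : ℕ}, n ≠ i + j → cop n i j = 0
  sgnOp : (n : ℕ) → ZMod 2 → T n →ₗ[k] T n
  sgnOp_apply : ∀ (n : ℕ) (p : ZMod 2) {γ : Γ} (x : T n), x ∈ tdeg n γ →
      sgnOp n p x = psign k p (GradingGroup.parity γ) • x
  d2 : (n : ℕ) → T (n + 1) →ₗ[k] T n
  d1 : (n : ℕ) → T n →ₗ[k] T n
  d0 : (n : ℕ) → T n →ₗ[k] T (n + 1)
  d2_gen : ∀ (n : ℕ) (a : ℕ → R.A) (g : ℕ → Γ), R.HomogBar (n + 1) g a →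
      d2 n (tgen (n + 1) a) = ∑ j ∈ Finset.range n,
        gsign k (degSum g (j + 1) - ((j + 1 : ℕ) : Γ)) • tgen n (contractChain a j)
  d1_gen : ∀ (n : ℕ) (a : ℕ → R.A) (g : ℕ → Γ), R.HomogBar n g a →
      d1 n (tgen n a) = ∑ j ∈ Finset.range n,
        gsign k (degSum g j - ((j + 1 : ℕ) : Γ)) •
          tgen n (Function.update a j (R.d (a j)))
  d0_gen : ∀ (n : ℕ) (a : ℕ → R.A) (g : ℕ → Γ), R.HomogBar n g a →
      d0 n (tgen n a) = ∑ j ∈ Finset.range (n + 1),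
        gsign k (degSum g j - (j : Γ)) • tgen (n + 1) (insertAt a j R.hEl)

attribute [instance] BarParts.addT BarParts.modT

variable {k Γ : Type} [Field k] [GradingGroup Γ] {R : CurvedDGA k Γ}

/-- The convolution product `f ⋆ g` on `Hom_k(T, A)` (elements recorded by their
components `T n →ₗ A`), for `g` of parity `p`: `f ⋆ g = μ ∘ (f ⊗ g) ∘ Δ`, the Koszul
sign `(−1)^{|g||x|}` in the evaluation of `f ⊗ g` being implemented by the sign
operator `sgnOp − p` applied on the first tensor factor. -/
def convP (P : BarParts k Γ R) (p : ZMod 2) (f g : ∀ n, P.T n →ₗ[k] R.A) :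
    ∀ n, P.T n →ₗ[k] R.A :=
  fun n => ∑ i ∈ Finset.range (n + 1),
    (LinearMap.mul' k R.A) ∘ₗ
      (TensorProduct.map ((f i) ∘ₗ (P.sgnOp i p)) (g (n - i))) ∘ₗ (P.cop n i (n - i))

/-- The component family of `f ∘ δ_T`. -/
def compDelta (P : BarParts k Γ R) (f : ∀ n, P.T n →ₗ[k] R.A) :
    ∀ n, P.T n →ₗ[k] R.A :=
  fun n =>
    match n with
    | 0 => (f 1) ∘ₗ (P.d0 0) + (f 0) ∘ₗ (P.d1 0)
    | m + 1 => (f m) ∘ₗ (P.d2 m) + (f (m + 1)) ∘ₗ (P.d1 (m + 1)) +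
        (f (m + 2)) ∘ₗ (P.d0 (m + 1))

/-- The differential `d_Hom(f) = d ∘ f − (−1)^{|f|} f ∘ δ_T` on `Hom_k(T, A)`, for
`f` homogeneous of degree `γf`. -/
def dHomP (P : BarParts k Γ R) (γf : Γ) (f : ∀ n, P.T n →ₗ[k] R.A) :
    ∀ n, P.T n →ₗ[k] R.A :=
  fun n => R.d ∘ₗ f n - gsign k γf • compDelta P f n

/-- `f : Hom_k(T, A)` is homogeneous of degree `γf`. -/
def HomogMap (P : BarParts k Γ R) (γf : Γ) (f : ∀ n, P.T n →ₗ[k] R.A) : Prop :=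
  ∀ (n : ℕ) (γ : Γ) (x : P.T n), x ∈ P.tdeg n γ → f n x ∈ R.deg (γ + γf)

/-- The deformed differential `d_τ = d_Hom − [τ, −]⋆` on `Hom_k(T, A)`, for an
argument homogeneous of degree `γf`:
`d_τ(f) = d_Hom(f) − (τ ⋆ f − (−1)^{|τ||f|} f ⋆ τ)`. -/
def dTauP (P : BarParts k Γ R) (tauH : ∀ n, P.T n →ₗ[k] R.A) (γf : Γ)
    (f : ∀ n, P.T n →ₗ[k] R.A) : ∀ n, P.T n →ₗ[k] R.A :=
  dHomP P γf f -
    (convP P (GradingGroup.parity γf) tauH f -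
      gsign2 k 1 γf • convP P (GradingGroup.parity (1 : Γ)) f tauH)



lemma gsign_zero : gsign k (0 : Γ) = 1 := by simp [gsign]

lemma gsign_one : gsign k (1 : Γ) = -1 := by
  simp [gsign, GradingGroup.parity_one, ZMod.val_one]

lemma gsign_add (γ γ' : Γ) : gsign k (γ + γ') = gsign k γ * gsign k γ' := by
  unfold gsign
  rw [map_add, ← pow_add, ZMod.val_add, ← neg_one_pow_eq_pow_mod_two]

lemma gsign_mul_self (γ : Γ) : gsign k γ * gsign k γ = 1 := by
  unfold gsign
  rw [← mul_pow]
  simp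

lemma gsign_neg (γ : Γ) : gsign k (-γ) = gsign k γ := by
  simp [gsign, ZMod.neg_eq_self_mod_two]

lemma gsign_sub (γ γ' : Γ) : gsign k (γ - γ') = gsign k γ * gsign k γ' := by
  rw [sub_eq_add_neg, gsign_add, gsign_neg]

lemma gsign_two : gsign k (2 : Γ) = 1 := by
  rw [← one_add_one_eq_two, gsign_add, gsign_mul_self]

lemma parity_two : GradingGroup.parity (2 : Γ) = 0 := by
  have h : (2 : Γ) = 1 + 1 := one_add_one_eq_two.symm
  rw [h, map_add]
  exact CharTwo.add_self_eq_zero _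

/-- A homogeneous element of a curved dga together with a chosen degree. -/
structure HomogElt (R : CurvedDGA k Γ) where
  deg : Γ
  val : R.A
  mem : val ∈ R.deg deg

namespace HomogElt

/-- The product of homogeneous elements. -/
def mul (x y : HomogElt R) : HomogElt R := ⟨x.deg + y.deg, x.val * y.val, R.mul_mem x.mem y.mem⟩

/-- The differential of a homogeneous element. -/
def diff (x : HomogElt R) : HomogElt R := ⟨x.deg + 1, R.d x.val, R.d_deg x.mem⟩

/-- The curvature as a homogeneous element. -/
def curv (R : CurvedDGA k Γ) : HomogElt R := ⟨2, R.hEl, R.h_deg⟩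

/-- The Koszul sign of the suspension of `x`. -/
def sgn (x : HomogElt R) : k := gsign k (x.deg - 1)

lemma sgn_mul_self (x : HomogElt R) : x.sgn * x.sgn = 1 := gsign_mul_self _

lemma gsign_deg (x : HomogElt R) : gsign k x.deg = -x.sgn := by
  simp [sgn, gsign_sub, gsign_one]

lemma sgn_diff (x : HomogElt R) : x.diff.sgn = -x.sgn := by
  simp [sgn, diff, gsign_sub, gsign_one]

lemma sgn_mul (x y : HomogElt R) : (x.mul y).sgn = -(x.sgn * y.sgn) := by
  simp [sgn, mul, gsign_sub, gsign_add, gsign_one]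

lemma sgn_curv : (curv R).sgn = -1 := by
  simp [sgn, curv, gsign_sub, gsign_two, gsign_one]

/-- The sequence of values of a list, extended by zero. -/
def vals : List (HomogElt R) → ℕ → R.A
  | [], _ => 0
  | x :: _, 0 => x.val
  | _ :: l, i + 1 => vals l i

/-- The sequence of degrees of a list, extended by zero. -/
def degs : List (HomogElt R) → ℕ → Γ
  | [], _ => 0
  | x :: _, 0 => x.deg
  | _ :: l, i + 1 => degs l i

lemma homogBar (l : List (HomogElt R)) : R.HomogBar l.length (degs l) (vals l) := by
  induction l with
  | nil => intro i hi; simp at hi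
  | cons x l ih =>
    rintro (_ | i) hi
    · exact x.mem
    · exact ih i (by simpa using hi)

lemma exists_list {n : ℕ} {g : ℕ → Γ} {a : ℕ → R.A} (h : R.HomogBar n g a) :
    ∃ l : List (HomogElt R), l.length = n ∧ ∀ i < n, a i = vals l i := by
  induction n generalizing g a with
  | zero => exact ⟨[], rfl, by simp⟩
  | succ n ih =>
    obtain ⟨l, hl, hv⟩ := ih (g := fun i => g (i + 1)) (a := fun i => a (i + 1))
      fun i hi => h (i + 1) (by omega)
    refine ⟨⟨g 0, a 0, h 0 (by omega)⟩ :: l, by simp [hl], ?_⟩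
    rintro (_ | i) hi
    · rfl
    · exact hv i (by omega)

end HomogElt

open HomogElt

section ListDifferential

variable {M : Type} [AddCommGroup M] [Module k M]

/-- Multiply the head of a list by `x` before applying `φ`. -/
def mulHead (x : HomogElt R) (φ : List (HomogElt R) → M) : List (HomogElt R) → M
  | [] => 0
  | y :: l => φ (x.mul y :: l)

/-- The transpose of the bar differential, acting on functions of bar words. -/
def barD : (List (HomogElt R) → M) → List (HomogElt R) → M
  | φ, [] => φ [curv R]
  | φ, x :: l => φ (curv R :: x :: l) - φ (x.diff :: l) + x.sgn • mulHead x φ l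
      + x.sgn • barD (fun l' => φ (x :: l')) l

lemma barD_add (φ ψ : List (HomogElt R) → M) (l : List (HomogElt R)) :
    barD (fun l => φ l + ψ l) l = barD φ l + barD ψ l := by
  induction l generalizing φ ψ with
  | nil => simp [barD]
  | cons x l ih =>
    simp only [barD, ih]
    cases l <;> simp only [mulHead] <;> module

lemma barD_smul (c : k) (φ : List (HomogElt R) → M) (l : List (HomogElt R)) :
    barD (fun l => c • φ l) l = c • barD φ l := by
  induction l generalizing φ with
  | nil => simp [barD]
  | cons x l ih =>
    simp only [barD, ih]
    cases l <;> simp only [mulHead] <;> module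

lemma barD_sub (φ ψ : List (HomogElt R) → M) (l : List (HomogElt R)) :
    barD (fun l => φ l - ψ l) l = barD φ l - barD ψ l := by
  have h := barD_add (fun l => φ l - ψ l) ψ l
  simp only [sub_add_cancel] at h
  rw [h, add_sub_cancel_right]

/-- A function of bar words that is linear in (the value of) each letter. -/
def IsLetterLinear (φ : List (HomogElt R) → M) : Prop :=
  ∀ (p l : List (HomogElt R)) (x y z : HomogElt R) (c : k), z.val = x.val + c • y.val →
    φ (p ++ z :: l) = φ (p ++ x :: l) + c • φ (p ++ y :: l)

namespace IsLetterLinear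

variable {φ : List (HomogElt R) → M}

lemma cons (h : IsLetterLinear φ) (x : HomogElt R) : IsLetterLinear fun l => φ (x :: l) :=
  fun p => h (x :: p)

lemma head (h : IsLetterLinear φ) {x y z : HomogElt R} {c : k}
    (hz : z.val = x.val + c • y.val) (l : List (HomogElt R)) :
    φ (z :: l) = φ (x :: l) + c • φ (y :: l) :=
  h [] l x y z c hz

lemma head_congr (h : IsLetterLinear φ) {x z : HomogElt R} (hz : z.val = x.val)
    (l : List (HomogElt R)) : φ (z :: l) = φ (x :: l) := by
  simpa using h.head (y := x) (c := 0) (by simpa using hz) l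

theorem barD_barD (h : IsLetterLinear φ) (l : List (HomogElt R)) : barD (barD φ) l = 0 := by
  have h_curv : ∀ {φ : List (HomogElt R) → M}, IsLetterLinear φ →
      ∀ l, φ ((curv R).diff :: l) = 0 := fun {φ} h l => by
    have := h.head (x := (curv R).diff) (y := (curv R).diff) (z := (curv R).diff) (c := 1)
      (by simp [diff, curv, R.d_h]) l
    simpa using this
  induction l generalizing φ with
  | nil =>
    simp only [barD, mulHead, h_curv h, sgn_curv]
    module
  | cons x l ih =>
    have hdd : ∀ l, φ (x.diff.diff :: l) =
        φ ((curv R).mul x :: l) + (-1 : k) • φ (x.mul (curv R) :: l) := fun l =>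
      h.head (by simp [diff, mul, curv, R.d_sq, sub_eq_add_neg]) l
    have hs := x.sgn_mul_self
    have hsplit : barD (fun l' => barD φ (x :: l')) l =
        barD (fun l' => φ (curv R :: x :: l')) l - barD (fun l' => φ (x.diff :: l')) l
          + x.sgn • barD (mulHead x φ) l := by
      simp only [barD]
      rw [barD_add, barD_add, barD_sub, barD_smul, barD_smul, ih (h.cons x), smul_zero, add_zero]
    rw [barD, hsplit]
    cases l with
    | nil =>
      simp only [barD, mulHead, h_curv h, sgn_curv, sgn_diff, hdd]
      match_scalars <;> grind
    | cons y l =>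
      have hL : ∀ l, φ ((x.mul y).diff :: l) =
          φ (x.diff.mul y :: l) + (-x.sgn) • φ (x.mul y.diff :: l) := fun l =>
        h.head (by simp [diff, mul, R.d_leibniz x.mem, gsign_deg]) l
      have hM : ∀ z : HomogElt R, ∀ l, φ ((x.mul y).mul z :: l) = φ (x.mul (y.mul z) :: l) :=
        fun z l => h.head_congr (by simp [mul, mul_assoc]) l
      cases l with
      | nil =>
        simp only [barD, mulHead, h_curv h, sgn_curv, sgn_diff, sgn_mul, hdd, hL]
        match_scalars <;> grind
      | cons z l =>
        simp only [barD, mulHead, h_curv h, sgn_curv, sgn_diff, sgn_mul, hdd, hL, hM]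
        match_scalars <;> grind

end IsLetterLinear
end ListDifferential

/-- Prepend a term to a sequence. -/
def consSeq {E : Type} (x : E) (a : ℕ → E) : ℕ → E
  | 0 => x
  | i + 1 => a i

lemma insertAt_zero {E : Type} (a : ℕ → E) (x : E) : insertAt a 0 x = consSeq x a := by
  funext i
  cases i <;> simp [insertAt, consSeq]

lemma insertAt_consSeq {E : Type} (x y : E) (a : ℕ → E) (j : ℕ) :
    insertAt (consSeq x a) (j + 1) y = consSeq x (insertAt a j y) := by
  funext i
  rcases i with _ | _ | i <;> simp [insertAt, consSeq, eq_comm (a := j)]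
  grind

lemma update_consSeq_zero {E : Type} (x y : E) (a : ℕ → E) :
    Function.update (consSeq x a) 0 y = consSeq y a := by
  funext i
  cases i <;> simp [Function.update, consSeq]

lemma update_consSeq_succ {E : Type} (x y : E) (a : ℕ → E) (j : ℕ) :
    Function.update (consSeq x a) (j + 1) y = consSeq x (Function.update a j y) := by
  funext i
  cases i <;> simp [Function.update, consSeq]

lemma contractChain_consSeq_zero {E : Type} [Mul E] (x y : E) (a : ℕ → E) :
    contractChain (consSeq x (consSeq y a)) 0 = consSeq (x * y) a := by
  funext i
  cases i <;> simp [contractChain, consSeq]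

lemma contractChain_consSeq_succ {E : Type} [Mul E] (x : E) (a : ℕ → E) (j : ℕ) :
    contractChain (consSeq x a) (j + 1) = consSeq x (contractChain a j) := by
  funext i
  cases i <;> simp [contractChain, consSeq]

lemma gsign_degSum_consSeq (γ : Γ) (g : ℕ → Γ) (j m : ℕ) :
    gsign k (degSum (consSeq γ g) (j + 1) - ((m + 1 : ℕ) : Γ)) =
      gsign k (γ - 1) * gsign k (degSum g j - (m : Γ)) := by
  rw [← gsign_add, degSum, Finset.sum_range_succ']
  congr 1
  simp only [consSeq, degSum]
  push_cast
  abel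

lemma HomogElt.vals_cons (x : HomogElt R) (l : List (HomogElt R)) :
    vals (x :: l) = consSeq x.val (vals l) := by
  funext i
  cases i <;> rfl

lemma HomogElt.degs_cons (x : HomogElt R) (l : List (HomogElt R)) :
    degs (x :: l) = consSeq x.deg (degs l) := by
  funext i
  cases i <;> rfl

lemma barD_eq_sum {M : Type} [AddCommGroup M] [Module k M] (l : List (HomogElt R))
    (φ : List (HomogElt R) → M) (Φ₀ Φ₁ Φ₂ : (ℕ → R.A) → M)
    (h₀ : ∀ l', l'.length = l.length + 1 → φ l' = Φ₀ (vals l'))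
    (h₁ : ∀ l', l'.length = l.length → φ l' = Φ₁ (vals l'))
    (h₂ : ∀ l', l'.length + 1 = l.length → φ l' = Φ₂ (vals l')) :
    barD φ l =
      ∑ j ∈ range (l.length - 1), gsign k (degSum (degs l) (j + 1) - ((j + 1 : ℕ) : Γ)) •
          Φ₂ (contractChain (vals l) j) +
        ∑ j ∈ range l.length, gsign k (degSum (degs l) j - ((j + 1 : ℕ) : Γ)) •
          Φ₁ (Function.update (vals l) j (R.d (vals l j))) +
        ∑ j ∈ range (l.length + 1), gsign k (degSum (degs l) j - (j : Γ)) •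
          Φ₀ (insertAt (vals l) j R.hEl) := by
  induction l generalizing φ Φ₀ Φ₁ Φ₂ with
  | nil =>
    rw [barD, h₀ [curv R] rfl, vals_cons]
    simp [insertAt_zero, degSum, gsign_zero, curv]
  | cons x l ih =>
    rw [barD, ih (fun l' => φ (x :: l')) (fun a => Φ₀ (consSeq x.val a))
        (fun a => Φ₁ (consSeq x.val a)) (fun a => Φ₂ (consSeq x.val a))
        (fun l' hl => by rw [h₀ _ (by simp [hl]), vals_cons])
        (fun l' hl => by rw [h₁ _ (by simp [hl]), vals_cons])
        (fun l' hl => by rw [h₂ _ (by simp [hl]), vals_cons]),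
      h₀ _ (by simp), h₁ _ (by simp)]
    have h_zero : gsign k (degSum (degs (x :: l)) 0 - ((0 : ℕ) : Γ)) = 1 := by
      simp [degSum, gsign_zero]
    have h_one : gsign k (degSum (degs (x :: l)) 0 - ((0 + 1 : ℕ) : Γ)) = -1 := by
      simp [degSum, gsign_neg, gsign_one]
    have hcontract : ∑ j ∈ range ((x :: l).length - 1),
          gsign k (degSum (degs (x :: l)) (j + 1) - ((j + 1 : ℕ) : Γ)) •
            Φ₂ (contractChain (vals (x :: l)) j) =
        x.sgn • mulHead x φ l + x.sgn • ∑ j ∈ range (l.length - 1),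
          gsign k (degSum (degs l) (j + 1) - ((j + 1 : ℕ) : Γ)) •
            Φ₂ (consSeq x.val (contractChain (vals l) j)) := by
      cases l with
      | nil => simp [mulHead]
      | cons y l =>
        have h_sgn : gsign k (degSum (degs (x :: y :: l)) (0 + 1) - ((0 + 1 : ℕ) : Γ)) =
            x.sgn := by
          rw [degs_cons, gsign_degSum_consSeq]
          simp [degSum, gsign_zero, sgn]
        rw [List.length_cons, Nat.add_sub_cancel, List.length_cons, Finset.sum_range_succ', h_sgn,
          add_comm, mulHead, h₂ _ (by simp), Finset.smul_sum]
        congr 1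
        · rw [vals_cons, vals_cons, vals_cons, contractChain_consSeq_zero]
          rfl
        · refine Finset.sum_congr rfl fun j _ => ?_
          rw [degs_cons x, gsign_degSum_consSeq, vals_cons x, contractChain_consSeq_succ, mul_smul]
          rfl
    rw [hcontract, List.length_cons, Finset.sum_range_succ' _ (l.length + 1),
      Finset.sum_range_succ' (fun j => gsign k (degSum (degs (x :: l)) j - ((j + 1 : ℕ) : Γ)) •
        Φ₁ (Function.update (vals (x :: l)) j (R.d (vals (x :: l) j)))) l.length, h_zero, h_one]
    simp only [degs_cons, gsign_degSum_consSeq, vals_cons, insertAt_zero, insertAt_consSeq,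
      update_consSeq_zero, update_consSeq_succ, mul_smul, ← Finset.smul_sum, smul_add]
    simp only [sgn, diff, curv, consSeq]
    module

/-- Evaluation of a family of maps on the bar word of a list. -/
def barEval (P : BarParts k Γ R) (f : ∀ n, P.T n →ₗ[k] R.A) (l : List (HomogElt R)) : R.A :=
  f l.length (P.tgen l.length (vals l))

lemma barEval_eq (P : BarParts k Γ R) (f : ∀ n, P.T n →ₗ[k] R.A) {l : List (HomogElt R)} {n : ℕ}
    (h : l.length = n) : barEval P f l = f n (P.tgen n (vals l)) := by
  subst h
  rfl

lemma barEval_compDelta (P : BarParts k Γ R) (f : ∀ n, P.T n →ₗ[k] R.A) :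
    barEval P (compDelta P f) = barD (barEval P f) := by
  funext l
  cases l with
  | nil =>
    rw [barD_eq_sum [] _ (fun a => f 1 (P.tgen 1 a)) (fun a => f 0 (P.tgen 0 a)) 0
      (fun l' hl => barEval_eq P f hl) (fun l' hl => barEval_eq P f hl)
      (fun l' hl => by simp at hl)]
    simp only [barEval, compDelta, List.length_nil, LinearMap.add_apply, LinearMap.comp_apply]
    rw [P.d0_gen 0 _ _ (homogBar []), P.d1_gen 0 _ _ (homogBar [])]
    simp
  | cons x l =>
    rw [barD_eq_sum (x :: l) _ (fun a => f (l.length + 2) (P.tgen _ a))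
      (fun a => f (l.length + 1) (P.tgen _ a)) (fun a => f l.length (P.tgen _ a))
      (fun l' hl => barEval_eq P f hl) (fun l' hl => barEval_eq P f hl)
      (fun l' hl => barEval_eq P f (by simpa using hl))]
    simp only [barEval, compDelta, List.length_cons, LinearMap.add_apply, LinearMap.comp_apply]
    rw [P.d0_gen (l.length + 1) _ _ (homogBar (x :: l)),
      P.d1_gen (l.length + 1) _ _ (homogBar (x :: l)),
      P.d2_gen l.length _ _ (homogBar (x :: l))]
    simp only [map_sum, map_smul, Nat.add_sub_cancel]

lemma vals_append_cons (p l : List (HomogElt R)) (x z : HomogElt R) :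
    vals (p ++ z :: l) = Function.update (vals (p ++ x :: l)) p.length z.val := by
  induction p with
  | nil => simp [vals_cons, update_consSeq_zero]
  | cons y p ih =>
    rw [List.cons_append, List.cons_append, vals_cons, vals_cons, List.length_cons,
      update_consSeq_succ, ih]

lemma isLetterLinear_barEval (P : BarParts k Γ R) (f : ∀ n, P.T n →ₗ[k] R.A) :
    IsLetterLinear (barEval P f) := by
  intro p l x y z c hz
  have hlen : ∀ w : HomogElt R, (p ++ w :: l).length = p.length + l.length + 1 := fun w => by
    simp [add_assoc]
  rw [barEval_eq P f (hlen x), barEval_eq P f (hlen y), barEval_eq P f (hlen z),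
    vals_append_cons p l x z, vals_append_cons p l x y, hz, P.tgen_add _ _ _ (by omega),
    P.tgen_smul _ _ _ (by omega), map_add, map_smul, ← vals_append_cons]

lemma BarParts.hom_ext (P : BarParts k Γ R) {M : Type} [AddCommGroup M] [Module k M] {n : ℕ}
    {f g : P.T n →ₗ[k] M}
    (h : ∀ l : List (HomogElt R), l.length = n → f (P.tgen n (vals l)) = g (P.tgen n (vals l))) :
    f = g := by
  refine LinearMap.ext_on (P.span_tgen n) ?_
  rintro _ ⟨a, γ, ha, rfl⟩
  obtain ⟨l, hl, hv⟩ := exists_list ha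
  rw [P.tgen_ext hv]
  exact h l hl

lemma compDelta_compDelta (P : BarParts k Γ R) (f : ∀ n, P.T n →ₗ[k] R.A) :
    compDelta P (compDelta P f) = 0 := by
  funext n
  refine P.hom_ext fun l hl => ?_
  rw [← barEval_eq P _ hl, barEval_compDelta, barEval_compDelta,
    (isLetterLinear_barEval P f).barD_barD]
  rfl

lemma dHomP_dHomP (P : BarParts k Γ R) (γ : Γ) (f : ∀ n, P.T n →ₗ[k] R.A) (n : ℕ) :
    dHomP P (γ + 1) (dHomP P γ f) n = R.d ∘ₗ R.d ∘ₗ f n := by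
  have hlin : compDelta P (dHomP P γ f) n =
      R.d ∘ₗ compDelta P f n - gsign k γ • compDelta P (compDelta P f) n := by
    cases n <;> ext x <;> simp [compDelta, dHomP] <;> abel
  rw [compDelta_compDelta] at hlin
  ext x
  simp only [dHomP] at hlin ⊢
  simp [hlin, gsign_add, gsign_one]

lemma BarParts.cop_tgen (P : BarParts k Γ R) {n i j : ℕ} (h : n = i + j) (a : ℕ → R.A) :
    P.cop n i j (P.tgen n a) = P.tgen i a ⊗ₜ[k] P.tgen j (fun t => a (t + i)) := by
  subst h
  exact P.cop_gen i j a

lemma BarParts.sgnOp_tgen_zero (P : BarParts k Γ R) (p : ZMod 2) (a : ℕ → R.A) :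
    P.sgnOp 0 p (P.tgen 0 a) = P.tgen 0 a := by
  rw [P.sgnOp_apply 0 p _ (P.tgen_deg (g := 0) fun i hi => by omega)]
  simp [degSum, psign]

lemma BarParts.sgnOp_zero (P : BarParts k Γ R) (n : ℕ) : P.sgnOp n 0 = LinearMap.id := by
  refine P.hom_ext fun l hl => ?_
  subst hl
  rw [P.sgnOp_apply _ 0 _ (P.tgen_deg (homogBar l))]
  simp [psign]

lemma convP_hEps_left (P : BarParts k Γ R) {hEps : ∀ n, P.T n →ₗ[k] R.A}
    (hEps0 : ∀ a : ℕ → R.A, hEps 0 (P.tgen 0 a) = R.hEl) (hEpsS : ∀ n : ℕ, hEps (n + 1) = 0)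
    (p : ZMod 2) (f : ∀ n, P.T n →ₗ[k] R.A) (n : ℕ) :
    convP P p hEps f n = LinearMap.mulLeft k R.hEl ∘ₗ f n := by
  refine P.hom_ext fun l _ => ?_
  rw [convP, Finset.sum_eq_single_of_mem 0 (by simp)]
  · simp only [LinearMap.comp_apply, Nat.sub_zero]
    rw [P.cop_tgen (by simp)]
    simp [P.sgnOp_tgen_zero, hEps0]
  · rintro (_ | i) _ hi
    · exact absurd rfl hi
    · simp [hEpsS]

lemma convP_hEps_right (P : BarParts k Γ R) {hEps : ∀ n, P.T n →ₗ[k] R.A}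
    (hEps0 : ∀ a : ℕ → R.A, hEps 0 (P.tgen 0 a) = R.hEl) (hEpsS : ∀ n : ℕ, hEps (n + 1) = 0)
    (f : ∀ n, P.T n →ₗ[k] R.A) (n : ℕ) :
    convP P 0 f hEps n = LinearMap.mulRight k R.hEl ∘ₗ f n := by
  have h_top : ∀ m, m = 0 → ∀ a, hEps m (P.tgen m a) = R.hEl := by
    rintro _ rfl
    exact hEps0
  have h_pos : ∀ m, m ≠ 0 → hEps m = 0 := by
    rintro (_ | m) hm
    · exact absurd rfl hm
    · exact hEpsS m
  refine P.hom_ext fun l _ => ?_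
  rw [convP, Finset.sum_eq_single_of_mem n (by simp)]
  · simp only [LinearMap.comp_apply]
    rw [P.cop_tgen (by simp)]
    simp [P.sgnOp_zero, h_top (n - n) (by simp)]
  · intro i hi hin
    rw [h_pos (n - i) (by have := Finset.mem_range.1 hi; omega)]
    simp

lemma dHomP_hEps (P : BarParts k Γ R) {hEps : ∀ n, P.T n →ₗ[k] R.A}
    (hEps0 : ∀ a : ℕ → R.A, hEps 0 (P.tgen 0 a) = R.hEl) (hEpsS : ∀ n : ℕ, hEps (n + 1) = 0) :
    dHomP P (2 : Γ) hEps = 0 := by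
  funext n
  refine P.hom_ext fun l hl => ?_
  subst hl
  rcases l with _ | ⟨x, _ | ⟨y, l⟩⟩
  · simp [dHomP, compDelta, hEps0, hEpsS, R.d_h, P.d1_gen 0 _ _ (homogBar [])]
  · have := P.d2_gen 0 _ _ (homogBar [x])
    simp at this
    simp [dHomP, compDelta, hEpsS, this]
  · simp [dHomP, compDelta, hEpsS]

/-- Let `k` be a field and `(A, d, h)` a cdga over `k`.  On
`Hom_k(T, A)` with convolution `⋆` and differential
`d_Hom(f) = d ∘ f − (−1)^{|f|} f ∘ δ_T`, one has `d_Hom ∘ d_Hom = [h∘ε, −]⋆` (the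
convolution commutator with the degree-two element `h∘ε`) and `d_Hom(h∘ε) = 0`;
consequently `(Hom_k(T,A), ⋆, d_Hom, h∘ε)` is a curved differential `Γ`-graded
algebra over `k`.  The identities are stated for homogeneous `f`. -/
theorem dHom_squared_is_curvature_commutator
    (k Γ : Type) [Field k] [GradingGroup Γ]
    (R : CurvedDGA k Γ) (P : BarParts k Γ R)
    -- the element `h ∘ ε : T → k → A` :
    (hEps : ∀ n, P.T n →ₗ[k] R.A)
    (hEps0 : ∀ a : ℕ → R.A, hEps 0 (P.tgen 0 a) = R.hEl)
    (hEpsS : ∀ n : ℕ, hEps (n + 1) = 0) :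
    (∀ (γf : Γ) (f : ∀ n, P.T n →ₗ[k] R.A), HomogMap P γf f →
      dHomP P (γf + 1) (dHomP P γf f) =
        convP P (GradingGroup.parity γf) hEps f -
          convP P (GradingGroup.parity (2 : Γ)) f hEps) ∧
    dHomP P (2 : Γ) hEps = 0 := by
  refine ⟨fun γf f _ => funext fun n => ?_, dHomP_hEps P hEps0 hEpsS⟩
  rw [dHomP_dHomP, Pi.sub_apply, parity_two, convP_hEps_left P hEps0 hEpsS,
    convP_hEps_right P hEps0 hEpsS]
  ext x
  simp [R.d_sq]

end
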